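/- Let β = 1/25, ε₀ = 1/16, γ = 72 and c = 10. Then for all integers d ≥ 0 and n ≥ k ≥ d + c, and every f : F₂ⁿ → F₂ with δ_d(f) ≥ β · 2^{−d}, one has Rej_{d,k}(f) ≥ ε₀ + γ · 2^d / 2^n. -/

import Mathlib

open scoped Classical

noncomputable section

/-- `f : 𝔽₂ⁿ → 𝔽₂` has degree at most `d` (as a multilinear polynomial). -/
def degLE (n d : ℕ) (f : (Fin n → ZMod 2) → ZMod 2) : Prop :=
  ∃ p : MvPolynomial (Fin n) (ZMod 2), p.totalDegree ≤ d ∧ ∀ x, MvPolynomial.eval x p = f x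

/-- fractional Hamming distance between two functions on 𝔽₂ⁿ. -/
def hdist (n : ℕ) (f g : (Fin n → ZMod 2) → ZMod 2) : ℝ :=
  ((Finset.univ.filter fun x => f x ≠ g x).card : ℝ) / 2 ^ n

/-- distance of `f` to the Reed–Muller code RM(d,n). -/
def deltaD (n d : ℕ) (f : (Fin n → ZMod 2) → ZMod 2) : ℝ :=
  sInf {r : ℝ | ∃ g, degLE n d g ∧ r = hdist n f g}

/-- Rejection probability of the `k`-flat test: a uniformly random `k`-flat is chosen
(via a uniformly random injective affine parametrization `u ↦ M u + b`), and the test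
rejects iff the restriction of `f` does not have degree at most `d`. -/
def Rej (n d k : ℕ) (f : (Fin n → ZMod 2) → ZMod 2) : ℝ :=
  ((Finset.univ.filter fun Mb : Matrix (Fin n) (Fin k) (ZMod 2) × (Fin n → ZMod 2) =>
      Function.Injective Mb.1.mulVec ∧
        ¬ degLE k d (fun u => f (Mb.1.mulVec u + Mb.2))).card : ℝ) /
  ((Finset.univ.filter fun Mb : Matrix (Fin n) (Fin k) (ZMod 2) × (Fin n → ZMod 2) =>
      Function.Injective Mb.1.mulVec).card : ℝ)

/-- Rejection probability of the (d+1)-fold derivative (Gowers norm) test. -/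
def Rej0 (n d : ℕ) (f : (Fin n → ZMod 2) → ZMod 2) : ℝ :=
  ((Finset.univ.filter fun xa : (Fin n → ZMod 2) × (Fin (d+1) → Fin n → ZMod 2) =>
      (∑ S : Finset (Fin (d+1)), f (xa.1 + ∑ i ∈ S, xa.2 i)) = 1).card : ℝ) /
  ((2 ^ n) * (2 ^ n) ^ (d+1) : ℝ)

/-- the (d+1)-st Gowers norm of `f`. -/
def gowersNorm (n d : ℕ) (f : (Fin n → ZMod 2) → ZMod 2) : ℝ :=
  (1 - 2 * Rej0 n d f) ^ ((1 : ℝ) / 2 ^ (d+1))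

/-- t-fold XOR of `f`, as a function on 𝔽₂^(t·n). -/
def xorPow (n t : ℕ) (f : (Fin n → ZMod 2) → ZMod 2) :
    (Fin (t * n) → ZMod 2) → ZMod 2 :=
  fun x => ∑ i : Fin t, f fun j => x (finProdFinEquiv (i, j))

/-- elementary symmetric polynomial of degree m on n variables over 𝔽₂. -/
def symPoly (n m : ℕ) : (Fin n → ZMod 2) → ZMod 2 :=
  fun x => ∑ I ∈ Finset.powersetCard m Finset.univ, ∏ i ∈ I, x i

/-- the hyperplane `{x : L·x = b}`. -/
def hyp (n : ℕ) (L : Fin n → ZMod 2) (b : ZMod 2) : Set (Fin n → ZMod 2) :=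
  {x | ∑ i, L i * x i = b}

/-- `f` has degree less than `d`: all its `d`-fold derivatives vanish. -/
def DegLT {V : Type} [AddCommGroup V] : ℕ → (V → ZMod 2) → Prop
  | 0, f => ∀ x, f x = 0
  | d + 1, f => ∀ a, DegLT d (fun x => f (x + a) + f x)

section DegLT

variable {V W : Type} [AddCommGroup V] [AddCommGroup W]

theorem DegLT.zero (d : ℕ) : DegLT d (fun _ : V => 0) := by
  induction d with
  | zero => intro x; rfl
  | succ d ih => intro a; simpa using ih

theorem DegLT.add {d : ℕ} {f g : V → ZMod 2} (hf : DegLT d f) (hg : DegLT d g) :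
    DegLT d (fun x => f x + g x) := by
  induction d generalizing f g with
  | zero => intro x; simp [hf x, hg x]
  | succ d ih =>
    intro a
    convert ih (hf a) (hg a) using 2
    ring

theorem DegLT.sum {ι : Type} {d : ℕ} (s : Finset ι) {f : ι → V → ZMod 2}
    (hf : ∀ i ∈ s, DegLT d (f i)) : DegLT d (fun x => ∑ i ∈ s, f i x) := by
  induction s using Finset.induction_on with
  | empty => simpa using DegLT.zero d
  | insert i s hi ih =>
    simp only [Finset.sum_insert hi]
    exact (hf i (by simp)).add (ih fun j hj => hf j (by simp [hj]))

theorem DegLT.succ {d : ℕ} {f : V → ZMod 2} (hf : DegLT d f) : DegLT (d + 1) f := by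
  induction d generalizing f with
  | zero => intro a x; simp [hf x, hf (x + a)]
  | succ d ih => intro a; exact ih (hf a)

theorem DegLT.mono {d e : ℕ} (h : d ≤ e) {f : V → ZMod 2} (hf : DegLT d f) : DegLT e f := by
  induction e, h using Nat.le_induction with
  | base => exact hf
  | succ e _ ih => exact ih.succ

theorem DegLT.comp_of_map_add {d : ℕ} {f : V → ZMod 2} (hf : DegLT d f) (φ : W → V) (L : W → V)
    (h : ∀ x a, φ (x + a) = φ x + L a) : DegLT d (fun x => f (φ x)) := by
  induction d generalizing f with
  | zero => intro x; exact hf _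
  | succ d ih =>
    intro a
    simpa only [h] using ih (hf (L a))

theorem DegLT.comp_add_left {d : ℕ} {f : V → ZMod 2} (hf : DegLT d f) (b : V) :
    DegLT d (fun x => f (b + x)) :=
  hf.comp_of_map_add _ id fun x a => by simp [add_assoc]

theorem DegLT.comp_affine [Module (ZMod 2) V] [Module (ZMod 2) W] {d : ℕ} {f : V → ZMod 2}
    (hf : DegLT d f) (φ : W →ᵃ[ZMod 2] V) : DegLT d (fun x => f (φ x)) :=
  hf.comp_of_map_add φ φ.linear fun x a => by
    have := φ.map_vadd x a
    simp only [vadd_eq_add] at this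
    rw [add_comm x, this, add_comm]

theorem DegLT.linear_mul {d : ℕ} {f : V → ZMod 2} (hf : DegLT d f) (L : V →+ ZMod 2) :
    DegLT (d + 1) (fun x => L x * f x) := by
  induction d generalizing f with
  | zero => intro a x; simp [hf x, hf (x + a)]
  | succ d ih =>
    intro a
    have h1 := ih (hf a)
    have h2 : DegLT (d + 1) (fun x => if L a = 0 then 0 else f (a + x)) := by
      split_ifs
      · exact DegLT.zero _
      · exact hf.comp_add_left a
    convert h1.add h2 using 2 with x
    have h01 : ∀ z : ZMod 2, z = 0 ∨ z = 1 := by decide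
    simp only [map_add, add_comm a x]
    rcases h01 (L a) with h | h <;> simp [h]
    · ring
    · ring

/-- A nonzero function of degree at most `d` is nonzero on at least a `2⁻ᵈ` fraction of points. -/
theorem DegLT.card_le [Fintype V] {d : ℕ} {f : V → ZMod 2} (hf : DegLT (d + 1) f) {x₀ : V}
    (h0 : f x₀ ≠ 0) : Fintype.card V ≤ 2 ^ d * (Finset.univ.filter fun x => f x ≠ 0).card := by
  induction d generalizing f x₀ with
  | zero =>
    have : (Finset.univ.filter fun x => f x ≠ 0) = Finset.univ := by
      ext x
      have := hf (x - x₀) x₀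
      simp only [add_sub_cancel] at this
      have h2 : f x = f x₀ := by
        generalize f x = u at *
        generalize f x₀ = v at *
        revert u v; decide
      simp [h2, h0]
    simp [this]
  | succ d ih =>
    by_cases h : ∃ a x, f (x + a) + f x ≠ 0
    · obtain ⟨a, x, hx⟩ := h
      refine (ih (hf a) hx).trans ?_
      rw [pow_succ, mul_assoc]
      refine Nat.mul_le_mul_left _ ?_
      have hsub : (Finset.univ.filter fun x => f (x + a) + f x ≠ 0) ⊆
          ((Finset.univ.filter fun x => f x ≠ 0).image fun x => x - a) ∪
          (Finset.univ.filter fun x => f x ≠ 0) := by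
        intro y hy
        simp only [Finset.mem_filter, Finset.mem_univ, true_and, Finset.mem_union,
          Finset.mem_image] at hy ⊢
        by_cases h1 : f y = 0
        · left
          exact ⟨y + a, by simpa [h1] using hy, by simp⟩
        · exact Or.inr h1
      refine (Finset.card_le_card hsub).trans ((Finset.card_union_le _ _).trans ?_)
      rw [two_mul]
      exact Nat.add_le_add_right Finset.card_image_le _
    · push Not at h
      have h1 : DegLT (d + 1) f := by
        refine DegLT.mono (d := 1) (by omega) ?_
        exact fun a x => h a x
      refine (ih h1 h0).trans ?_
      gcongr <;> omega

theorem DegLT.sum_eq_zero {n d : ℕ} (h : d ≤ n) {f : (Fin n → ZMod 2) → ZMod 2}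
    (hf : DegLT d f) : ∑ x, f x = 0 := by
  replace hf := hf.mono h
  clear h
  induction n with
  | zero => exact Finset.sum_eq_zero fun x _ => hf x
  | succ n ih =>
    have h1 := (hf (Pi.single 0 1)).comp_of_map_add (fun y : Fin n → ZMod 2 => Fin.cons 0 y)
      (fun y => Fin.cons 0 y) (fun x a => by
        ext i; refine Fin.cases ?_ (fun j => ?_) i <;> simp)
    have h2 := ih h1
    rw [← (Fin.consEquiv fun _ => ZMod 2).sum_comp, Fintype.sum_prod_type]
    have hu : (Finset.univ : Finset (ZMod 2)) = {0, 1} := by decide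
    rw [hu, Finset.sum_pair (by decide), ← Finset.sum_add_distrib]
    refine Eq.trans (Finset.sum_congr rfl fun y _ => ?_) h2
    rw [add_comm]
    congr 2
    ext i; refine Fin.cases ?_ (fun j => ?_) i <;> simp [Fin.consEquiv]

theorem degLT_of_degLE {n d : ℕ} {f : (Fin n → ZMod 2) → ZMod 2} (hf : degLE n d f) :
    DegLT (d + 1) f := by
  obtain ⟨p, hp, hpf⟩ := hf
  have hmon : ∀ (s : Multiset (Fin n)) , DegLT (s.card + 1)
      (fun x : Fin n → ZMod 2 => (s.map x).prod) := by
    intro s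
    induction s using Multiset.induction_on with
    | empty => intro a x; simp; decide
    | cons i s ih =>
      have := ih.linear_mul (Pi.evalAddMonoidHom (fun _ => ZMod 2) i)
      simpa using this
  have : f = fun x => ∑ s ∈ p.support, MvPolynomial.coeff s p *
      ((Finsupp.toMultiset s).map x).prod := by
    ext x
    rw [← hpf, MvPolynomial.eval_eq]
    refine Finset.sum_congr rfl fun s _ => ?_
    rw [Finsupp.toMultiset_map, Finsupp.prod_toMultiset, Finsupp.prod_mapDomain_index (by simp)
      (by intros; exact pow_add _ _ _)]
    rfl
  rw [this]
  refine DegLT.sum _ fun s hs => ?_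
  have hc : MvPolynomial.coeff s p = 1 := by
    have h01 : ∀ z : ZMod 2, z ≠ 0 → z = 1 := by decide
    exact h01 _ (MvPolynomial.mem_support_iff.1 hs)
  simp only [hc, one_mul]
  refine (hmon (Finsupp.toMultiset s)).mono ?_
  rw [Finsupp.card_toMultiset]
  exact Nat.succ_le_succ ((MvPolynomial.le_totalDegree hs).trans hp)

theorem degLE_of_degLT {n d : ℕ} {f : (Fin n → ZMod 2) → ZMod 2} (hf : DegLT (d + 1) f) :
    degLE n d f := by
  induction n generalizing d with
  | zero =>
    refine ⟨MvPolynomial.C (f 0), by simp, fun x => ?_⟩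
    rw [MvPolynomial.eval_C, Subsingleton.elim x 0]
  | succ n ih =>
    have hcons : ∀ x a : Fin n → ZMod 2,
        (Fin.cons 0 (x + a) : Fin (n + 1) → ZMod 2) = Fin.cons 0 x + Fin.cons 0 a := by
      intro x a
      ext i; refine Fin.cases ?_ (fun j => ?_) i <;> simp
    have h0 := hf.comp_of_map_add (fun y : Fin n → ZMod 2 => Fin.cons 0 y)
      (fun y => Fin.cons 0 y) hcons
    have h1 := (hf (Pi.single 0 1)).comp_of_map_add (fun y : Fin n → ZMod 2 => Fin.cons 0 y)
      (fun y => Fin.cons 0 y) hcons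
    have hsplit : ∀ x, f x = f (Fin.cons 0 (Fin.tail x)) + x 0 *
        (f (Fin.cons 0 (Fin.tail x) + Pi.single 0 1) + f (Fin.cons 0 (Fin.tail x))) := by
      intro x
      have h01 : ∀ z : ZMod 2, z = 0 ∨ z = 1 := by decide
      rcases h01 (x 0) with h | h
      · rw [h, zero_mul, add_zero, ← h, Fin.cons_self_tail]
      · have : (Fin.cons 0 (Fin.tail x) + Pi.single 0 1 : Fin (n + 1) → ZMod 2) = x := by
          ext i; refine Fin.cases ?_ (fun j => ?_) i <;> simp [h, Fin.tail]
        rw [this, h]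
        generalize f x = u
        generalize f _ = v
        revert u v; decide
    obtain ⟨p, hp, hpf⟩ := ih h0
    have heval : ∀ (q : MvPolynomial (Fin n) (ZMod 2)) (x : Fin (n + 1) → ZMod 2),
        MvPolynomial.eval x (MvPolynomial.rename Fin.succ q) =
          MvPolynomial.eval (Fin.tail x) q := by
      intro q x
      rw [MvPolynomial.eval_rename]; rfl
    cases d with
    | zero =>
      refine ⟨MvPolynomial.rename Fin.succ p, (MvPolynomial.totalDegree_rename_le _ _).trans hp,
        fun x => ?_⟩
      rw [heval, hpf, hsplit x]
      have := h1 (Fin.tail x)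
      simp only at this
      rw [this, mul_zero, add_zero]
    | succ d =>
      obtain ⟨q, hq, hqf⟩ := ih h1
      refine ⟨MvPolynomial.rename Fin.succ p + MvPolynomial.X 0 * MvPolynomial.rename Fin.succ q,
        ?_, fun x => ?_⟩
      · refine (MvPolynomial.totalDegree_add _ _).trans (max_le
          ((MvPolynomial.totalDegree_rename_le _ _).trans hp)
          ((MvPolynomial.totalDegree_mul _ _).trans ?_))
        have := MvPolynomial.totalDegree_rename_le Fin.succ q
        rw [MvPolynomial.totalDegree_X]
        omega
      · rw [hsplit x, map_add, map_mul, heval, heval, hpf, hqf, MvPolynomial.eval_X]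

theorem degLE_iff_degLT {n d : ℕ} {f : (Fin n → ZMod 2) → ZMod 2} :
    degLE n d f ↔ DegLT (d + 1) f :=
  ⟨degLT_of_degLE, degLE_of_degLT⟩

end DegLT

section Averaging

open scoped BigOperators

/-- Averaging over a transitive action of a finite group equals uniform averaging. -/
theorem expect_transitive {G X : Type} [Group G] [Fintype G] [Fintype X] (act : G → X → X)
    (hone : ∀ x, act 1 x = x) (hmul : ∀ g h x, act (g * h) x = act g (act h x))
    (htrans : ∀ x y, ∃ g, act g x = y) (F : X → ℝ) (x₀ : X) :
    𝔼 g, F (act g x₀) = 𝔼 x, F x := by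
  have h1 : ∀ x, 𝔼 g, F (act g x) = 𝔼 g, F (act g x₀) := by
    intro x
    obtain ⟨h, rfl⟩ := htrans x₀ x
    exact Fintype.expect_equiv (Equiv.mulRight h) _ _ fun g => by simp [hmul]
  have : Nonempty X := ⟨x₀⟩
  calc 𝔼 g, F (act g x₀) = 𝔼 _x : X, 𝔼 g, F (act g x₀) := (Fintype.expect_const _).symm
    _ = 𝔼 x, 𝔼 g, F (act g x) := by simp_rw [h1]
    _ = 𝔼 g, 𝔼 x, F (act g x) := Finset.expect_comm _ _ _
    _ = 𝔼 _g : G, 𝔼 x, F x := by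
      refine Finset.expect_congr rfl fun g _ => ?_
      refine Fintype.expect_equiv ⟨act g, act g⁻¹, fun x => ?_, fun x => ?_⟩ _ _ fun x => rfl
      · rw [← hmul, inv_mul_cancel, hone]
      · rw [← hmul, mul_inv_cancel, hone]
    _ = 𝔼 x, F x := Fintype.expect_const _

variable {U V W : Type} [AddCommGroup U] [Module (ZMod 2) U] [AddCommGroup V] [Module (ZMod 2) V]
  [AddCommGroup W] [Module (ZMod 2) W]

/-- Injective affine maps. -/
abbrev AffInj (U V : Type) [AddCommGroup U] [Module (ZMod 2) U] [AddCommGroup V]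
    [Module (ZMod 2) V] : Type :=
  {φ : U →ᵃ[ZMod 2] V // Function.Injective φ}

instance affineMapFintype [Finite U] [Finite V] : Fintype (U →ᵃ[ZMod 2] V) :=
  @Fintype.ofFinite _ (DFunLike.finite _)

instance affineEquivFintype [Finite V] : Fintype (V ≃ᵃ[ZMod 2] V) :=
  @Fintype.ofFinite _ (DFunLike.finite _)

/-- Composition of injective affine maps. -/
def AffInj.comp (φ : AffInj W V) (ψ : AffInj U W) : AffInj U V :=
  ⟨φ.1.comp ψ.1, φ.2.comp ψ.2⟩

/-- Postcomposition of an injective affine map with an affine automorphism. -/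
def AffInj.smul (g : V ≃ᵃ[ZMod 2] V) (φ : AffInj U V) : AffInj U V :=
  ⟨g.toAffineMap.comp φ.1, g.injective.comp φ.2⟩

theorem exists_linearEquiv_comp_eq [Finite V] (φ ψ : U →ₗ[ZMod 2] V) (hφ : Function.Injective φ)
    (hψ : Function.Injective ψ) : ∃ e : V ≃ₗ[ZMod 2] V, ∀ x, e (φ x) = ψ x := by
  obtain ⟨C, hC⟩ := (LinearMap.range φ).exists_isCompl
  obtain ⟨D, hD⟩ := (LinearMap.range ψ).exists_isCompl
  let e1 : LinearMap.range φ ≃ₗ[ZMod 2] LinearMap.range ψ :=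
    (LinearEquiv.ofInjective φ hφ).symm.trans (LinearEquiv.ofInjective ψ hψ)
  have hfin : Module.finrank (ZMod 2) C = Module.finrank (ZMod 2) D := by
    have h1 := Submodule.finrank_add_eq_of_isCompl hC
    have h2 := Submodule.finrank_add_eq_of_isCompl hD
    have h3 := e1.finrank_eq
    omega
  let e2 : C ≃ₗ[ZMod 2] D := LinearEquiv.ofFinrankEq C D hfin
  refine ⟨(Submodule.prodEquivOfIsCompl _ _ hC).symm.trans
    ((e1.prodCongr e2).trans (Submodule.prodEquivOfIsCompl _ _ hD)), fun x => ?_⟩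
  have h1 : (Submodule.prodEquivOfIsCompl _ _ hC).symm (φ x) =
      (LinearEquiv.ofInjective φ hφ x, 0) := by
    rw [LinearEquiv.symm_apply_eq]; simp
  simp [h1, e1]

theorem AffInj.exists_smul_eq [Finite V] (φ ψ : AffInj U V) :
    ∃ g : V ≃ᵃ[ZMod 2] V, φ.smul g = ψ := by
  obtain ⟨e, he⟩ := exists_linearEquiv_comp_eq φ.1.linear ψ.1.linear
    (φ.1.linear_injective_iff.2 φ.2) (ψ.1.linear_injective_iff.2 ψ.2)
  refine ⟨e.toAffineEquiv.trans (AffineEquiv.constVAdd (ZMod 2) V (ψ.1 0 - e (φ.1 0))),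
    Subtype.ext (AffineMap.ext fun x => ?_)⟩
  have h1 : φ.1 x = φ.1.linear x + φ.1 0 := by simpa using φ.1.map_vadd 0 x
  have h2 : ψ.1 x = ψ.1.linear x + ψ.1 0 := by simpa using ψ.1.map_vadd 0 x
  simp [AffInj.smul, h1, h2, he]
  abel

variable [Fintype U] [Fintype V] [Fintype W]

theorem AffInj.expect_smul (φ : AffInj U V) (F : AffInj U V → ℝ) :
    𝔼 g : V ≃ᵃ[ZMod 2] V, F (φ.smul g) = 𝔼 ψ, F ψ :=
  expect_transitive (fun g φ => AffInj.smul g φ) (fun _ => rfl) (fun _ _ _ => rfl)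
    AffInj.exists_smul_eq F φ

/-- The probability that a random affine copy of `U` in `V` detects that `f` has degree at
least `d`. -/
def rejProb (U : Type) {V : Type} [AddCommGroup U] [Module (ZMod 2) U] [AddCommGroup V]
    [Module (ZMod 2) V] [Fintype U] [Fintype V] (d : ℕ) (f : V → ZMod 2) : ℝ :=
  𝔼 φ : AffInj U V, if DegLT d (fun u => f (φ.1 u)) then 0 else 1

theorem rejProb_nonneg (d : ℕ) (f : V → ZMod 2) : 0 ≤ rejProb U d f :=
  Finset.expect_nonneg fun φ _ => by split_ifs <;> norm_num

theorem rejProb_eq_one [Nonempty (AffInj U V)] {d : ℕ} {f : V → ZMod 2}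
    (h : ∀ φ : AffInj U V, ¬ DegLT d (fun u => f (φ.1 u))) : rejProb U d f = 1 :=
  (Finset.expect_congr rfl fun φ _ => if_neg (h φ)).trans (Fintype.expect_const (1 : ℝ))

theorem rejProb_eq_sum_div_card {X : Type} [Fintype X] (e : X ≃ AffInj U V) (d : ℕ)
    (f : V → ZMod 2) :
    rejProb U d f =
      (∑ x, if DegLT d (fun u => f ((e x).1 u)) then 0 else 1) / (Fintype.card X : ℝ) := by
  rw [rejProb, Fintype.expect_eq_sum_div_card, ← e.sum_comp, Fintype.card_congr e]

theorem rejProb_mono (φ : AffInj W V) (ψ : AffInj U W) (d : ℕ) (f : V → ZMod 2) :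
    rejProb U d f ≤ rejProb W d f := by
  rw [rejProb, rejProb, ← (φ.comp ψ).expect_smul, ← φ.expect_smul]
  refine Finset.expect_le_expect fun g _ => ?_
  by_cases h : DegLT d (fun u => f ((φ.smul g).1 u))
  · have : DegLT d (fun u => f (((φ.comp ψ).smul g).1 u)) := h.comp_affine ψ.1
    rw [if_pos h, if_pos this]
  · rw [if_neg h]
    split_ifs <;> norm_num

theorem rejProb_eq_expect (φ : AffInj W V) (hU : Nonempty (AffInj U W)) (d : ℕ) (f : V → ZMod 2) :
    rejProb U d f =
      𝔼 g : V ≃ᵃ[ZMod 2] V, rejProb U d (fun w => f ((φ.smul g).1 w)) := by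
  simp only [rejProb]
  rw [Finset.expect_comm]
  refine (Fintype.expect_const (ι := AffInj U W) _).symm.trans
    (Finset.expect_congr rfl fun ψ _ => ?_)
  exact ((φ.comp ψ).expect_smul _).symm

theorem card_filter_expect {X : Type} [Fintype X] (p : X → Prop) [DecidablePred p] :
    𝔼 x, (if p x then (1 : ℝ) else 0) = (Finset.univ.filter p).card / Fintype.card X := by
  rw [Fintype.expect_eq_sum_div_card, Finset.sum_boole]

/-- The pointwise evaluation of a random injective affine map is uniform. -/
theorem AffInj.expect_apply [Nonempty (AffInj U V)] (u : U) (F : V → ℝ) :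
    𝔼 φ : AffInj U V, F (φ.1 u) = 𝔼 x, F x := by
  obtain ⟨φ₀⟩ := ‹Nonempty (AffInj U V)›
  rw [← φ₀.expect_smul]
  refine expect_transitive (fun (g : V ≃ᵃ[ZMod 2] V) x => g x) (fun _ => rfl) (fun _ _ _ => rfl)
    (fun x y => ⟨AffineEquiv.constVAdd (ZMod 2) V (y - x), by simp⟩) F (φ₀.1 u)

theorem AffInj.expect_apply_pair [Nonempty (AffInj U V)] {u v : U} (h : u ≠ v)
    (F : V → V → ℝ) :
    𝔼 φ : AffInj U V, F (φ.1 u) (φ.1 v) = 𝔼 p : {p : V × V // p.1 ≠ p.2}, F p.1.1 p.1.2 := by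
  obtain ⟨φ₀⟩ := ‹Nonempty (AffInj U V)›
  rw [← φ₀.expect_smul]
  refine expect_transitive (X := {p : V × V // p.1 ≠ p.2})
    (fun (g : V ≃ᵃ[ZMod 2] V) p => ⟨(g p.1.1, g p.1.2), fun h => p.2 (g.injective h)⟩)
    (fun _ => rfl) (fun _ _ _ => rfl) ?_ (fun p => F p.1.1 p.1.2)
    ⟨(φ₀.1 u, φ₀.1 v), fun h' => h (φ₀.2 h')⟩
  rintro ⟨⟨a, b⟩, hab⟩ ⟨⟨a', b'⟩, hab'⟩
  obtain ⟨g, hg⟩ := AffInj.exists_smul_eq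
    (⟨AffineMap.lineMap a b, AffineMap.lineMap_injective _ hab⟩ : AffInj (ZMod 2) V)
    ⟨AffineMap.lineMap a' b', AffineMap.lineMap_injective _ hab'⟩
  have hg' : ∀ t : ZMod 2, g (AffineMap.lineMap a b t) = AffineMap.lineMap a' b' t := fun t =>
    congrArg (fun φ : AffInj (ZMod 2) V => φ.1 t) hg
  refine ⟨g, Subtype.ext (Prod.ext ?_ ?_)⟩
  · simpa using hg' 0
  · simpa using hg' 1

theorem card_offDiag_subtype (X : Type) [Fintype X] :
    Fintype.card {p : X × X // p.1 ≠ p.2} =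
      Fintype.card X * Fintype.card X - Fintype.card X := by
  rw [Fintype.card_subtype, ← Finset.card_univ, ← Finset.offDiag_card]
  congr 1
  ext p
  simp

/-- Lower bound on the rejection probability of functions close to low-degree ones. -/
theorem rejProb_lower {m d : ℕ} (hd : d ≤ m) [Nonempty (AffInj (Fin m → ZMod 2) V)]
    (f Q : V → ZMod 2) (hQ : DegLT d Q) (δ : ℝ)
    (hδ : δ = (Finset.univ.filter fun x => f x ≠ Q x).card / Fintype.card V) :
    2 ^ m * δ - (2 ^ m * δ) ^ 2 ≤ rejProb (Fin m → ZMod 2) d f := by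
  set U := Fin m → ZMod 2
  set S := Finset.univ.filter fun x => f x ≠ Q x with hS
  let I : V → ℝ := fun x => if f x ≠ Q x then 1 else 0
  have hUcard : (Fintype.card U : ℝ) = 2 ^ m := by simp [U]
  have hI : 𝔼 x, I x = δ := by rw [hδ]; exact card_filter_expect (fun x => f x ≠ Q x)
  have hδ0 : 0 ≤ δ := by rw [hδ]; positivity
  have hpair : ∀ u v : U, u ≠ v → 𝔼 φ : AffInj U V, I (φ.1 u) * I (φ.1 v) ≤ δ ^ 2 := by
    intro u v huv
    rw [AffInj.expect_apply_pair huv (fun x y => I x * I y)]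
    have h1 : ∀ p : {p : V × V // p.1 ≠ p.2}, I p.1.1 * I p.1.2 =
        if (f p.1.1 ≠ Q p.1.1 ∧ f p.1.2 ≠ Q p.1.2) then 1 else 0 := by
      intro p
      simp only [I, ite_and, mul_ite, mul_one, mul_zero]
      split_ifs <;> rfl
    simp_rw [h1]
    rw [card_filter_expect, card_offDiag_subtype]
    have h2 : (Finset.univ.filter fun p : {p : V × V // p.1 ≠ p.2} =>
        (f p.1.1 ≠ Q p.1.1 ∧ f p.1.2 ≠ Q p.1.2)).card ≤ S.card * S.card - S.card := by
      rw [← Finset.offDiag_card]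
      refine Finset.card_le_card_of_injOn Subtype.val ?_ Subtype.val_injective.injOn
      intro p hp
      have hp' := p.2
      simp only [Finset.coe_filter, Finset.mem_univ, true_and, Set.mem_ofPred_eq] at hp
      simp [hS, hp.1, hp.2, hp']
    have h3 : S.card ≤ Fintype.card V := Finset.card_le_univ _
    set s := S.card
    set N := Fintype.card V
    rw [hδ, div_pow]
    rcases Nat.lt_or_ge N 2 with hN | hN
    · have : N * N - N = 0 := by
        interval_cases N <;> rfl
      rw [this]; simp; positivity
    · have hN' : (2 : ℝ) ≤ N := by exact_mod_cast hN
      have h3' : (s : ℝ) ≤ N := by exact_mod_cast h3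
      have hc : ∀ a : ℕ, ((a * a - a : ℕ) : ℝ) = a * a - a := by
        intro a
        rw [Nat.cast_sub (Nat.le_mul_self a)]; push_cast; rfl
      refine (div_le_div_of_nonneg_right (Nat.cast_le.2 h2) (by positivity)).trans ?_
      rw [hc, hc, div_le_div_iff₀ (by nlinarith) (by positivity)]
      have hs0 : (0 : ℝ) ≤ s := by positivity
      have : 0 ≤ (s : ℝ) * N * (N - s) := by
        have := sub_nonneg.2 h3'
        positivity
      nlinarith
  have hpt : ∀ φ : AffInj U V, ∑ u, I (φ.1 u) -
      ∑ u, ∑ v ∈ Finset.univ.erase u, I (φ.1 u) * I (φ.1 v) ≤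
      if DegLT d (fun u => f (φ.1 u)) then 0 else 1 := by
    intro φ
    let N := (Finset.univ.filter fun u => f (φ.1 u) ≠ Q (φ.1 u)).card
    have hN : ∑ u, I (φ.1 u) = N := Finset.sum_boole _ _
    have hN2 : ∑ u, ∑ v ∈ Finset.univ.erase u, I (φ.1 u) * I (φ.1 v) = N * N - N := by
      have : ∀ u, ∑ v ∈ Finset.univ.erase u, I (φ.1 u) * I (φ.1 v) = I (φ.1 u) * N - I (φ.1 u) := by
        intro u
        rw [Finset.sum_erase_eq_sub (Finset.mem_univ _), ← Finset.mul_sum, hN]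
        congr 1
        simp only [I]; split_ifs <;> norm_num
      simp_rw [this]
      rw [Finset.sum_sub_distrib, ← Finset.sum_mul, hN]
    rw [hN, hN2]
    have hodd : N = 1 → ¬ DegLT d (fun u => f (φ.1 u)) := by
      intro h1 hdeg
      have h2 := (hdeg.add (hQ.comp_affine φ.1)).sum_eq_zero hd
      have h3 : ∀ u, f (φ.1 u) + Q (φ.1 u) =
          if f (φ.1 u) ≠ Q (φ.1 u) then (1 : ZMod 2) else 0 := by
        intro u
        generalize f (φ.1 u) = a
        generalize Q (φ.1 u) = b
        revert a b; decide
      simp_rw [h3] at h2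
      rw [Finset.sum_boole] at h2
      change ((N : ℕ) : ZMod 2) = 0 at h2
      rw [h1] at h2
      exact absurd h2 (by decide)
    by_cases h1 : N = 1
    · rw [if_neg (hodd h1), h1]; norm_num
    · have : (N : ℝ) - (N * N - N) ≤ 0 := by
        rcases Nat.lt_or_ge N 1 with h | h
        · have : N = 0 := by omega
          rw [this]; norm_num
        · have : (2 : ℝ) ≤ N := by exact_mod_cast (by omega : 2 ≤ N)
          nlinarith
      refine this.trans ?_
      split_ifs <;> norm_num
  calc 2 ^ m * δ - (2 ^ m * δ) ^ 2 ≤ 2 ^ m * δ - ∑ u : U, ∑ v ∈ Finset.univ.erase u,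
        𝔼 φ : AffInj U V, I (φ.1 u) * I (φ.1 v) := by
        gcongr
        calc _ ≤ ∑ u : U, ∑ v ∈ Finset.univ.erase u, δ ^ 2 := by
              refine Finset.sum_le_sum fun u _ => Finset.sum_le_sum fun v hv => hpair u v ?_
              exact (Finset.ne_of_mem_erase hv).symm
          _ ≤ ∑ u : U, ∑ v : U, δ ^ 2 := by
              refine Finset.sum_le_sum fun u _ => ?_
              refine Finset.sum_le_sum_of_subset_of_nonneg (Finset.erase_subset _ _) ?_
              intros; positivity
          _ = (2 ^ m * δ) ^ 2 := by
              simp only [Finset.sum_const, Finset.card_univ, nsmul_eq_mul, hUcard]; ring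
    _ = 𝔼 φ : AffInj U V, (∑ u, I (φ.1 u) -
          ∑ u, ∑ v ∈ Finset.univ.erase u, I (φ.1 u) * I (φ.1 v)) := by
        rw [Finset.expect_sub_distrib, Finset.expect_sum_comm, Finset.expect_sum_comm]
        simp_rw [Finset.expect_sum_comm, AffInj.expect_apply, hI]
        simp [U]
    _ ≤ _ := Finset.expect_le_expect fun φ _ => hpt φ

end Averaging

section Hyperplanes

variable {V : Type} [AddCommGroup V] [Module (ZMod 2) V]

theorem AffineMap.apply_add_eq (ℓ : V →ᵃ[ZMod 2] ZMod 2) (x w : V) :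
    ℓ (x + w) = ℓ x + ℓ.linear w := by
  have := ℓ.map_vadd x w
  simpa [add_comm] using this

theorem AffineMap.apply_add_of_mem_ker {ℓ : V →ᵃ[ZMod 2] ZMod 2} {x w : V}
    (hw : ℓ.linear w = 0) : ℓ (x + w) = ℓ x := by
  rw [ℓ.apply_add_eq, hw, add_zero]

variable [Fintype V]

theorem card_le_card_ker_mul {U : Type} [AddCommGroup U] [Module (ZMod 2) U] [Fintype U]
    (M : V →ₗ[ZMod 2] U) :
    Fintype.card V ≤ Fintype.card (LinearMap.ker M) * Fintype.card U := by
  have h := Submodule.card_eq_card_quotient_mul_card (LinearMap.ker M)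
  have h2 : Nat.card (V ⧸ LinearMap.ker M) ≤ Nat.card U := by
    rw [Nat.card_congr M.quotKerEquivRange.toEquiv]
    exact Nat.card_le_card_of_injective _ Subtype.val_injective
  simp only [Nat.card_eq_fintype_card] at h h2
  rw [h]
  exact Nat.mul_le_mul_left _ (by simpa using h2)

theorem zmod_two_add_ne_zero {a b : ZMod 2} : a + b ≠ 0 ↔ a ≠ b := by
  revert a b; decide

/-- Two functions of degree at most `d` which differ somewhere on a coset of `W` differ on at least
a `2⁻ᵈ` fraction of it. -/
theorem DegLT.card_submodule_le {d : ℕ} {P Q : V → ZMod 2} (hP : DegLT (d + 1) P)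
    (hQ : DegLT (d + 1) Q) (W : Submodule (ZMod 2) V) {x₀ : V} (h : P x₀ ≠ Q x₀)
    (s : Finset V) (hs : ∀ w ∈ W, P (x₀ + w) ≠ Q (x₀ + w) → x₀ + w ∈ s) :
    Fintype.card W ≤ 2 ^ d * s.card := by
  have hdeg := (hP.add hQ).comp_of_map_add (fun w : W => x₀ + (w : V)) (fun w => (w : V))
    (fun x a => by simp [add_assoc])
  have := hdeg.card_le (x₀ := 0) (by simpa [zmod_two_add_ne_zero] using h)
  refine this.trans (Nat.mul_le_mul_left _ ?_)
  refine Finset.card_le_card_of_injOn (fun w : W => x₀ + (w : V)) ?_ ?_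
  · intro w hw
    simp only [Finset.coe_filter, Finset.mem_univ, true_and, Set.mem_ofPred_eq,
      zmod_two_add_ne_zero] at hw
    exact hs w w.2 hw
  · intro a _ b _ hab
    simpa using hab

theorem agree_on_inter {d : ℕ} {f P Q : V → ZMod 2} (hP : DegLT (d + 1) P)
    (hQ : DegLT (d + 1) Q) {ℓ ℓ' : V →ᵃ[ZMod 2] ZMod 2}
    (h : 50 * 2 ^ d * (Finset.univ.filter fun x => ℓ x = 0 ∧ f x ≠ P x).card < Fintype.card V)
    (h' : 50 * 2 ^ d * (Finset.univ.filter fun x => ℓ' x = 0 ∧ f x ≠ Q x).card < Fintype.card V)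
    {x : V} (hx : ℓ x = 0) (hx' : ℓ' x = 0) : P x = Q x := by
  by_contra hne
  have h1 := hP.card_submodule_le hQ (LinearMap.ker (ℓ.linear.prod ℓ'.linear)) hne
    ((Finset.univ.filter fun x => ℓ x = 0 ∧ f x ≠ P x) ∪
      (Finset.univ.filter fun x => ℓ' x = 0 ∧ f x ≠ Q x)) ?_
  · have h2 := card_le_card_ker_mul (ℓ.linear.prod ℓ'.linear)
    rw [Fintype.card_prod, ZMod.card] at h2
    have h3 := h1.trans (Nat.mul_le_mul_left _ (Finset.card_union_le _ _))
    rw [mul_add] at h3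
    rw [mul_assoc] at h h'
    omega
  · intro w hw hne
    have hw' : ℓ.linear w = 0 ∧ ℓ'.linear w = 0 := by simpa using hw
    have e1 : ℓ (x + w) = 0 := by rw [AffineMap.apply_add_of_mem_ker hw'.1, hx]
    have e2 : ℓ' (x + w) = 0 := by rw [AffineMap.apply_add_of_mem_ker hw'.2, hx']
    simp only [Finset.mem_union, Finset.mem_filter, Finset.mem_univ, true_and, e1, e2]
    by_contra hcon
    push Not at hcon
    exact hne (hcon.1.symm.trans hcon.2)

theorem card_linear_mem_le (S : Submodule (ZMod 2) (V →ₗ[ZMod 2] ZMod 2)) (j : ℕ)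
    (hS : Module.finrank (ZMod 2) S ≤ j) (K : Finset (V →ᵃ[ZMod 2] ZMod 2))
    (hK : ∀ ℓ ∈ K, ℓ.linear ∈ S) : K.card ≤ 2 ^ (j + 1) := by
  have : Finite (V →ₗ[ZMod 2] ZMod 2) := DFunLike.finite _
  have : Fintype S := Fintype.ofFinite _
  have h1 : Fintype.card (ZMod 2 × S) ≤ 2 ^ (j + 1) := by
    rw [Fintype.card_prod, Module.card_eq_pow_finrank (K := ZMod 2) (V := S), ZMod.card,
      pow_succ, mul_comm]
    gcongr
    norm_num
  refine le_trans ?_ h1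
  rw [← Fintype.card_coe]
  refine Fintype.card_le_of_injective
    (fun ℓ : K => ((ℓ.1 0, ⟨ℓ.1.linear, hK _ ℓ.2⟩) : ZMod 2 × S)) ?_
  rintro ⟨ℓ, h⟩ ⟨ℓ', h'⟩ heq
  simp only [Prod.mk.injEq, Subtype.mk.injEq] at heq
  refine Subtype.ext (AffineMap.ext_linear heq.2 (p := 0) heq.1)

/-- Compatible functions of degree at most `d` on more than `2ʲ` hyperplanes can be glued along a
subfamily of hyperplanes covering all but a `2⁻ʲ` fraction of the space. -/
theorem exists_stitch {d : ℕ} (K : Finset (V →ᵃ[ZMod 2] ZMod 2))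
    (P : (V →ᵃ[ZMod 2] ZMod 2) → V → ZMod 2) (hP : ∀ ℓ ∈ K, DegLT (d + 1) (P ℓ))
    (hagree : ∀ ℓ ∈ K, ∀ ℓ' ∈ K, ∀ x, ℓ x = 0 → ℓ' x = 0 → P ℓ x = P ℓ' x)
    (j : ℕ) (hj : 2 ^ j < K.card) :
    ∃ T ⊆ K, T.card ≤ j ∧ ∃ Q : V → ZMod 2, DegLT (d + 1) Q ∧
      (∀ ℓ ∈ T, ∀ x, ℓ x = 0 → Q x = P ℓ x) ∧
      (Finset.univ.filter fun x => ∀ ℓ ∈ T, ℓ x ≠ 0).card * 2 ^ j ≤ Fintype.card V := by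
  induction j with
  | zero =>
    exact ⟨∅, by simp, by simp, fun _ => 0, DegLT.zero _, by simp, by simp⟩
  | succ j ih =>
    obtain ⟨T, hTK, hTj, Q, hQ, hQT, hcard⟩ := ih (by rw [pow_succ] at hj; omega)
    obtain ⟨ℓ, hℓK, hℓ⟩ : ∃ ℓ ∈ K, ℓ.linear ∉
        Submodule.span (ZMod 2) (Set.range fun t : T => t.1.linear) := by
      by_contra hcon
      push Not at hcon
      refine absurd (card_linear_mem_le _ j ?_ K hcon) (by omega)
      refine (finrank_range_le_card _).trans ?_
      simpa using hTj
    obtain ⟨v, hvT, hv⟩ : ∃ v, (∀ t ∈ T, t.linear v = 0) ∧ ℓ.linear v = 1 := by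
      by_contra hcon
      push Not at hcon
      refine hℓ (mem_span_of_iInf_ker_le_ker fun v hv => ?_)
      simp only [Submodule.mem_iInf, LinearMap.mem_ker, Subtype.forall] at hv ⊢
      have h01 : ∀ z : ZMod 2, z ≠ 1 → z = 0 := by decide
      exact h01 _ (hcon v hv)
    have hadd := AffineMap.apply_add_eq (V := V)
    let π : V →ᵃ[ZMod 2] V :=
      { toFun := fun x => x + ℓ x • v
        linear := LinearMap.id + ℓ.linear.smulRight v
        map_vadd' := fun x a => by
          simp only [vadd_eq_add, LinearMap.add_apply, LinearMap.id_apply,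
            LinearMap.smulRight_apply]
          rw [add_comm a x, hadd, add_smul]
          abel }
    have hπ : ∀ x, π x = x + ℓ x • v := fun x => rfl
    have hπℓ : ∀ x, ℓ (π x) = 0 := by
      intro x
      rw [hπ, hadd, map_smul, hv, smul_eq_mul, mul_one]
      exact CharTwo.add_self_eq_zero _
    have hπt : ∀ t ∈ T, ∀ x, t (π x) = t x := by
      intro t ht x
      rw [hπ, hadd, map_smul, hvT t ht, smul_zero, add_zero]
    have hπfix : ∀ x, ℓ x = 0 → π x = x := by
      intro x hx; rw [hπ, hx, zero_smul, add_zero]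
    have hℓT : ℓ ∉ T := fun h => hℓ (Submodule.subset_span ⟨⟨ℓ, h⟩, rfl⟩)
    refine ⟨insert ℓ T, Finset.insert_subset hℓK hTK, ?_,
      fun x => Q x + (Q (π x) + P ℓ (π x)),
      hQ.add ((hQ.comp_affine π).add ((hP ℓ hℓK).comp_affine π)), ?_, ?_⟩
    · rw [Finset.card_insert_of_notMem hℓT]; omega
    · intro t ht x hx
      simp only
      rcases Finset.mem_insert.1 ht with rfl | ht
      · rw [hπfix x hx, ← add_assoc, CharTwo.add_self_eq_zero, zero_add]
      · have h1 := hQT t ht (π x) (by rw [hπt t ht, hx])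
        have h2 := hagree t (hTK ht) ℓ hℓK (π x) (by rw [hπt t ht, hx]) (hπℓ x)
        rw [h1, h2, CharTwo.add_self_eq_zero, add_zero, hQT t ht x hx]
    · refine le_trans ?_ hcard
      rw [pow_succ, mul_comm (2 ^ j) 2, ← mul_assoc]
      refine Nat.mul_le_mul_right _ ?_
      set A := Finset.univ.filter fun x => ∀ t ∈ insert ℓ T, t x ≠ 0 with hA
      have hmem : ∀ x ∈ A, ℓ x ≠ 0 ∧ ∀ t ∈ T, t x ≠ 0 := by
        intro x hx
        simpa [hA] using hx
      have hdisj : Disjoint A (A.image fun x => x + v) := by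
        rw [Finset.disjoint_left]
        intro x hx hx'
        obtain ⟨y, hy, rfl⟩ := Finset.mem_image.1 hx'
        have h1 := (hmem _ hx).1
        have h2 := (hmem _ hy).1
        rw [hadd, hv] at h1
        revert h1 h2
        generalize ℓ y = z
        revert z; decide
      rw [mul_two]
      nth_rewrite 2 [← Finset.card_image_of_injective A (add_left_injective v)]
      rw [← Finset.card_union_of_disjoint hdisj]
      refine Finset.card_le_card fun x hx => ?_
      simp only [Finset.mem_filter, Finset.mem_univ, true_and]
      rcases Finset.mem_union.1 hx with hx | hx
      · exact (hmem x hx).2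
      · obtain ⟨y, hy, rfl⟩ := Finset.mem_image.1 hx
        intro t ht
        rw [hadd, hvT t ht, add_zero]
        exact (hmem y hy).2 t ht

/-- Compatible functions of degree at most `d` on more than `2ᵈ⁺²` hyperplanes have a common extension
of degree at most `d`. -/
theorem exists_stitch_all {d : ℕ} (K : Finset (V →ᵃ[ZMod 2] ZMod 2))
    (P : (V →ᵃ[ZMod 2] ZMod 2) → V → ZMod 2) (hP : ∀ ℓ ∈ K, DegLT (d + 1) (P ℓ))
    (hagree : ∀ ℓ ∈ K, ∀ ℓ' ∈ K, ∀ x, ℓ x = 0 → ℓ' x = 0 → P ℓ x = P ℓ' x)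
    (hK : 2 ^ (d + 2) < K.card) :
    ∃ Q : V → ZMod 2, DegLT (d + 1) Q ∧ ∀ ℓ ∈ K, ∀ x, ℓ x = 0 → Q x = P ℓ x := by
  obtain ⟨T, hTK, -, Q, hQ, hQT, hcard⟩ := exists_stitch K P hP hagree (d + 2) hK
  refine ⟨Q, hQ, fun ℓ hℓ x hx => ?_⟩
  by_contra hne
  have h1 := hQ.card_submodule_le (hP ℓ hℓ) (LinearMap.ker ℓ.linear) hne
    (Finset.univ.filter fun x => ∀ t ∈ T, t x ≠ 0) ?_
  · have h2 := card_le_card_ker_mul ℓ.linear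
    rw [ZMod.card] at h2
    have h3 : 0 < Fintype.card V := Fintype.card_pos
    rw [pow_add] at hcard
    nlinarith
  · intro w hw hne
    simp only [Finset.mem_filter, Finset.mem_univ, true_and]
    intro t ht ht0
    refine hne ((hQT t ht _ ht0).trans (hagree t (hTK ht) ℓ hℓ _ ht0 ?_))
    rw [AffineMap.apply_add_of_mem_ker (by simpa using hw), hx]

/-- The nontrivial character of `ZMod 2`. -/
def signChar (z : ZMod 2) : ℝ := if z = 0 then 1 else -1

theorem signChar_add (a b : ZMod 2) : signChar (a + b) = signChar a * signChar b := by
  have h01 : ∀ z : ZMod 2, z = 0 ∨ z = 1 := by decide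
  have h11 : (1 : ZMod 2) + 1 = 0 := by decide
  rcases h01 a with rfl | rfl <;> rcases h01 b with rfl | rfl <;> simp [signChar, h11]

theorem sum_signChar_mul_le {ℓ ℓ' : V →ᵃ[ZMod 2] ZMod 2} (h : ℓ ≠ ℓ') :
    ∑ x, signChar (ℓ x) * signChar (ℓ' x) ≤ 0 := by
  simp_rw [← signChar_add]
  have hadd := AffineMap.apply_add_eq (V := V)
  by_cases hl : ℓ.linear = ℓ'.linear
  · refine Finset.sum_nonpos fun x _ => ?_
    have hne : ℓ x ≠ ℓ' x := fun hx => h (AffineMap.ext_linear hl (p := x) hx)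
    rw [signChar, if_neg (zmod_two_add_ne_zero.2 hne)]
    norm_num
  · obtain ⟨a, ha⟩ : ∃ a, ℓ.linear a ≠ ℓ'.linear a := by
      by_contra hcon
      push Not at hcon
      exact hl (LinearMap.ext hcon)
    have key : ∑ x, signChar (ℓ x + ℓ' x) = ∑ x, -signChar (ℓ x + ℓ' x) := by
      rw [← Equiv.sum_comp (Equiv.addRight a)]
      refine Finset.sum_congr rfl fun x _ => ?_
      simp only [Equiv.coe_addRight, hadd]
      rw [add_add_add_comm, signChar_add]
      have : signChar (ℓ.linear a + ℓ'.linear a) = -1 := by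
        rw [signChar, if_neg (zmod_two_add_ne_zero.2 ha)]
      rw [this]; ring
    rw [Finset.sum_neg_distrib] at key
    linarith

theorem sum_sq_sum_signChar_le (K : Finset (V →ᵃ[ZMod 2] ZMod 2)) :
    ∑ x, (∑ ℓ ∈ K, signChar (ℓ x)) ^ 2 ≤ K.card * Fintype.card V := by
  simp_rw [sq, Finset.sum_mul_sum]
  rw [Finset.sum_comm]
  calc _ ≤ ∑ ℓ ∈ K, (Fintype.card V : ℝ) := ?_
    _ = _ := by rw [Finset.sum_const, nsmul_eq_mul]
  refine Finset.sum_le_sum fun ℓ hℓ => ?_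
  rw [Finset.sum_comm, ← Finset.add_sum_erase _ _ hℓ]
  have h1 : ∑ x, signChar (ℓ x) * signChar (ℓ x) = Fintype.card V := by
    have : ∀ z, signChar z * signChar z = 1 := by
      intro z; unfold signChar; split_ifs <;> norm_num
    simp [this]
  rw [h1]
  have h2 : ∑ ℓ' ∈ K.erase ℓ, ∑ x, signChar (ℓ x) * signChar (ℓ' x) ≤ 0 :=
    Finset.sum_nonpos fun ℓ' h => sum_signChar_mul_le (Finset.ne_of_mem_erase h).symm
  linarith

/-- A function close to low degree on many hyperplanes is globally close to low degree. -/
theorem exists_close_of_many_hyperplanes {d : ℕ} (f : V → ZMod 2)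
    (K : Finset (V →ᵃ[ZMod 2] ZMod 2))
    (hclose : ∀ ℓ ∈ K, ∃ P : V → ZMod 2, DegLT (d + 1) P ∧
      50 * 2 ^ d * (Finset.univ.filter fun x => ℓ x = 0 ∧ f x ≠ P x).card < Fintype.card V)
    (hK : 2 ^ (d + 2) < K.card) :
    ∃ Q : V → ZMod 2, DegLT (d + 1) Q ∧
      ((Finset.univ.filter fun x => f x ≠ Q x).card : ℝ) / Fintype.card V ≤
        3 / (50 * 2 ^ d) + 9 / K.card := by
  choose! P hP hPc using hclose
  obtain ⟨Q, hQ, hQK⟩ := exists_stitch_all K P hP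
    (fun ℓ hℓ ℓ' hℓ' x hx hx' =>
      agree_on_inter (hP ℓ hℓ) (hP ℓ' hℓ') (hPc ℓ hℓ) (hPc ℓ' hℓ') hx hx')
    hK
  refine ⟨Q, hQ, ?_⟩
  set B := Finset.univ.filter fun x => f x ≠ Q x with hB
  have hk : (0 : ℝ) < K.card := by exact_mod_cast (Nat.zero_le _).trans_lt hK
  have hN : (0 : ℝ) < Fintype.card V := by exact_mod_cast Fintype.card_pos
  let Y : V → ℝ := fun x => ∑ ℓ ∈ K, if ℓ x = 0 then 1 else 0
  let Z : V → ℝ := fun x => ∑ ℓ ∈ K, signChar (ℓ x)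
  have hYZ : ∀ x, Y x = (K.card + Z x) / 2 := by
    intro x
    have : Z x = 2 * Y x - K.card := by
      simp only [Z, Y]
      rw [Finset.mul_sum, Finset.card_eq_sum_ones, Nat.cast_sum, ← Finset.sum_sub_distrib]
      refine Finset.sum_congr rfl fun ℓ _ => ?_
      unfold signChar; split_ifs <;> norm_num
    rw [this]; ring
  have hpt : ∀ x, 1 ≤ 3 / K.card * Y x + 9 / (K.card : ℝ) ^ 2 * Z x ^ 2 := by
    intro x
    have hY0 : 0 ≤ Y x := Finset.sum_nonneg fun ℓ _ => by split_ifs <;> norm_num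
    rcases le_or_gt ((K.card : ℝ) / 3) (Y x) with h | h
    · have : 3 / K.card * ((K.card : ℝ) / 3) = 1 := by field_simp
      have h2 := mul_le_mul_of_nonneg_left h (show 0 ≤ 3 / (K.card : ℝ) by positivity)
      have : 0 ≤ 9 / (K.card : ℝ) ^ 2 * Z x ^ 2 := by positivity
      linarith
    · have h1 : ((K.card : ℝ) / 3) ^ 2 ≤ Z x ^ 2 := by
        have := hYZ x
        nlinarith
      have : 9 / (K.card : ℝ) ^ 2 * ((K.card : ℝ) / 3) ^ 2 = 1 := by field_simp; norm_num
      have h2 := mul_le_mul_of_nonneg_left h1 (show 0 ≤ 9 / (K.card : ℝ) ^ 2 by positivity)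
      have : 0 ≤ 3 / K.card * Y x := by positivity
      linarith
  have hYB : ∑ x ∈ B, Y x ≤ K.card * (Fintype.card V / (50 * 2 ^ d)) := by
    simp only [Y]
    rw [Finset.sum_comm, ← nsmul_eq_mul]
    refine Finset.sum_le_card_nsmul _ _ _ fun ℓ hℓ => ?_
    rw [Finset.sum_boole, le_div_iff₀ (by positivity)]
    have h1 : B.filter (fun x => ℓ x = 0) ⊆
        Finset.univ.filter fun x => ℓ x = 0 ∧ f x ≠ P ℓ x := by
      intro x hx
      simp only [hB, Finset.mem_filter, Finset.mem_univ, true_and] at hx ⊢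
      exact ⟨hx.2, by rw [← hQK ℓ hℓ x hx.2]; exact hx.1⟩
    have h2 := Finset.card_le_card h1
    have h3 := hPc ℓ hℓ
    have h4 : 50 * 2 ^ d * (B.filter (fun x => ℓ x = 0)).card ≤ Fintype.card V :=
      (Nat.mul_le_mul_left _ h2).trans h3.le
    rw [mul_comm]
    exact_mod_cast h4
  have hZ : ∑ x, Z x ^ 2 ≤ K.card * Fintype.card V := sum_sq_sum_signChar_le K
  have hmain : (B.card : ℝ) ≤ 3 / K.card * ∑ x ∈ B, Y x +
      9 / (K.card : ℝ) ^ 2 * ∑ x, Z x ^ 2 := by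
    calc (B.card : ℝ) = ∑ x ∈ B, 1 := by simp
      _ ≤ ∑ x ∈ B, (3 / K.card * Y x + 9 / (K.card : ℝ) ^ 2 * Z x ^ 2) :=
        Finset.sum_le_sum fun x _ => hpt x
      _ = 3 / K.card * ∑ x ∈ B, Y x + 9 / (K.card : ℝ) ^ 2 * ∑ x ∈ B, Z x ^ 2 := by
        rw [Finset.sum_add_distrib, Finset.mul_sum, Finset.mul_sum]
      _ ≤ _ := by
        gcongr
        exact Finset.subset_univ _
  rw [div_le_iff₀ hN]
  calc (B.card : ℝ) ≤ 3 / K.card * (K.card * (Fintype.card V / (50 * 2 ^ d))) +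
      9 / (K.card : ℝ) ^ 2 * (K.card * Fintype.card V) := by
        refine hmain.trans ?_
        gcongr
    _ = _ := by field_simp

end Hyperplanes

section Induction

open scoped BigOperators

theorem exists_linearEquiv_dual_comp_eq {V : Type} [AddCommGroup V] [Module (ZMod 2) V] [Finite V]
    {L L' : V →ₗ[ZMod 2] ZMod 2} (hL : L ≠ 0) (hL' : L' ≠ 0) :
    ∃ e : V ≃ₗ[ZMod 2] V, ∀ x, L (e x) = L' x := by
  have : Finite (Module.Dual (ZMod 2) V) := DFunLike.finite _
  obtain ⟨e, he⟩ := exists_linearEquiv_comp_eq (V := Module.Dual (ZMod 2) V)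
    (LinearMap.toSpanSingleton (ZMod 2) (Module.Dual (ZMod 2) V) L)
    (LinearMap.toSpanSingleton (ZMod 2) (Module.Dual (ZMod 2) V) L')
    (smul_left_injective _ hL) (smul_left_injective _ hL')
  have he1 : e L = L' := by simpa using he 1
  refine ⟨(Module.evalEquiv (ZMod 2) V).trans
    (e.dualMap.trans (Module.evalEquiv (ZMod 2) V).symm), fun x => ?_⟩
  set y := ((Module.evalEquiv (ZMod 2) V).trans
    (e.dualMap.trans (Module.evalEquiv (ZMod 2) V).symm)) x with hy
  have h1 : Module.evalEquiv (ZMod 2) V y = e.dualMap (Module.evalEquiv (ZMod 2) V x) := by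
    rw [hy]; simp
  have h2 := congrArg (fun φ => φ L) h1
  simpa [he1] using h2

/-- Nonconstant affine functionals. -/
abbrev AffFunctional (V : Type) [AddCommGroup V] [Module (ZMod 2) V] : Type :=
  {ℓ : V →ᵃ[ZMod 2] ZMod 2 // ℓ.linear ≠ 0}

variable {V : Type} [AddCommGroup V] [Module (ZMod 2) V]

/-- The action of affine automorphisms on nonconstant affine functionals. -/
def AffFunctional.smul (g : V ≃ᵃ[ZMod 2] V) (ℓ : AffFunctional V) : AffFunctional V :=
  ⟨ℓ.1.comp g.symm.toAffineMap, fun h => ℓ.2 (LinearMap.ext fun x => by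
    have := LinearMap.congr_fun h (g.linear x)
    simpa using this)⟩

theorem AffFunctional.smul_apply (g : V ≃ᵃ[ZMod 2] V) (ℓ : AffFunctional V) (x : V) :
    (ℓ.smul g).1 x = ℓ.1 (g.symm x) := rfl

theorem AffFunctional.exists_smul_eq [Finite V] (ℓ ℓ' : AffFunctional V) :
    ∃ g : V ≃ᵃ[ZMod 2] V, ℓ.smul g = ℓ' := by
  obtain ⟨e, he⟩ := exists_linearEquiv_dual_comp_eq ℓ.2 ℓ'.2
  obtain ⟨c, hc⟩ : ∃ c, ℓ.1.linear c = ℓ'.1 0 - ℓ.1 0 :=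
    (LinearMap.surjective ℓ.2) _
  refine ⟨(e.toAffineEquiv.trans (AffineEquiv.constVAdd (ZMod 2) V c)).symm,
    Subtype.ext (AffineMap.ext fun x => ?_)⟩
  have h1 := ℓ'.1.apply_add_eq 0 x
  have h2 := ℓ.1.apply_add_eq 0 (c + e x)
  rw [zero_add, ℓ.1.linear.map_add, hc, he] at h2
  rw [zero_add] at h1
  rw [AffFunctional.smul_apply]
  change ℓ.1 (c + e x) = ℓ'.1 x
  rw [h1, h2]
  ring

variable [Fintype V]

theorem AffFunctional.expect_smul (ℓ : AffFunctional V) (F : AffFunctional V → ℝ) :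
    𝔼 g : V ≃ᵃ[ZMod 2] V, F (ℓ.smul g) = 𝔼 ℓ', F ℓ' :=
  expect_transitive (fun g ℓ => AffFunctional.smul g ℓ) (fun _ => rfl) (fun _ _ _ => rfl)
    AffFunctional.exists_smul_eq F ℓ

theorem AffFunctional.card_add_two_ge :
    2 * Fintype.card V ≤ Fintype.card (AffFunctional V) + 2 := by
  have : Finite (V →ₗ[ZMod 2] ZMod 2) := DFunLike.finite _
  have : Fintype (V →ₗ[ZMod 2] ZMod 2) := Fintype.ofFinite _
  have h1 : Fintype.card (V →ᵃ[ZMod 2] ZMod 2) = 2 * Fintype.card V := by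
    rw [Fintype.card_congr (AffineMap.toConstProdLinearMap (ZMod 2)).toEquiv, Fintype.card_prod,
      ZMod.card, Module.card_eq_pow_finrank (K := ZMod 2) (V := V →ₗ[ZMod 2] ZMod 2),
      Module.card_eq_pow_finrank (K := ZMod 2) (V := V)]
    congr 2
    exact Subspace.dual_finrank_eq
  have h2 : (Finset.univ.filter fun ℓ : V →ᵃ[ZMod 2] ZMod 2 => ¬ ℓ.linear ≠ 0).card ≤ 2 := by
    refine card_linear_mem_le ⊥ 0 (by simp) _ fun ℓ hℓ => ?_
    simpa using hℓ
  have h3 := Finset.card_filter_add_card_filter_not (s := Finset.univ)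
    (fun ℓ : V →ᵃ[ZMod 2] ZMod 2 => ℓ.linear ≠ 0)
  rw [Finset.card_univ, h1] at h3
  rw [Fintype.card_subtype]
  omega

/-- The standard inclusion of `𝔽₂ⁿ` as the coordinate hyperplane `x₀ = 0`. -/
def consZero (n : ℕ) : AffInj (Fin n → ZMod 2) (Fin (n + 1) → ZMod 2) :=
  ⟨LinearMap.toAffineMap
    { toFun := fun y => (Fin.cons 0 y : Fin (n + 1) → ZMod 2)
      map_add' := fun x y => by
        ext i; refine Fin.cases ?_ (fun j => ?_) i <;> simp
      map_smul' := fun c y => by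
        ext i; refine Fin.cases ?_ (fun j => ?_) i <;> simp },
    Fin.cons_right_injective (α := fun _ => ZMod 2) 0⟩

theorem nonempty_affInj {m n : ℕ} (h : m ≤ n) :
    Nonempty (AffInj (Fin m → ZMod 2) (Fin n → ZMod 2)) := by
  induction n, h using Nat.le_induction with
  | base => exact ⟨⟨AffineMap.id _ _, Function.injective_id⟩⟩
  | succ n _ ih => exact ih.map fun φ => (consZero n).comp φ

/-- The first coordinate, as a nonconstant affine functional. -/
def firstCoord (n : ℕ) : AffFunctional (Fin (n + 1) → ZMod 2) :=
  ⟨LinearMap.toAffineMap (LinearMap.proj 0), fun h => by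
    have := LinearMap.congr_fun h (Pi.single 0 1)
    simp at this⟩

theorem firstCoord_apply {n : ℕ} (x : Fin (n + 1) → ZMod 2) : (firstCoord n).1 x = x 0 := rfl

/-- `f` has relative distance at least `2⁻ᵈ / 25` from all functions of degree at most `d`. -/
def IsFar (d : ℕ) (f : V → ZMod 2) : Prop :=
  ∀ Q : V → ZMod 2, DegLT (d + 1) Q →
    Fintype.card V ≤ 25 * 2 ^ d * (Finset.univ.filter fun x => f x ≠ Q x).card

/-- On the hyperplane `ℓ = 0`, `f` is close to a function of degree at most `d`. -/
def IsCloseOn (d : ℕ) (f : V → ZMod 2) (ℓ : V →ᵃ[ZMod 2] ZMod 2) : Prop :=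
  ∃ P : V → ZMod 2, DegLT (d + 1) P ∧
    50 * 2 ^ d * (Finset.univ.filter fun x => ℓ x = 0 ∧ f x ≠ P x).card < Fintype.card V

theorem isFar_of_not_isCloseOn {n d : ℕ} {f : (Fin (n + 1) → ZMod 2) → ZMod 2}
    (g : (Fin (n + 1) → ZMod 2) ≃ᵃ[ZMod 2] (Fin (n + 1) → ZMod 2))
    (h : ¬ IsCloseOn d f ((firstCoord n).smul g).1) :
    IsFar d (fun w => f (((consZero n).smul g).1 w)) := by
  intro Q hQ
  by_contra! hlt
  refine h ⟨fun x => Q (Fin.tail (g.symm x)), ?_, ?_⟩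
  · exact hQ.comp_affine
      ((LinearMap.funLeft (ZMod 2) (ZMod 2) Fin.succ).toAffineMap.comp g.symm.toAffineMap)
  · have hle : (Finset.univ.filter fun x => ((firstCoord n).smul g).1 x = 0 ∧
        f x ≠ Q (Fin.tail (g.symm x))).card ≤
        (Finset.univ.filter fun w => f (((consZero n).smul g).1 w) ≠ Q w).card := by
      have hback : ∀ x, ((firstCoord n).smul g).1 x = 0 →
          ((consZero n).smul g).1 (Fin.tail (g.symm x)) = x := by
        intro x hx
        rw [AffFunctional.smul_apply, firstCoord_apply] at hx
        change g (Fin.cons 0 (Fin.tail (g.symm x))) = x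
        rw [← hx, Fin.cons_self_tail, AffineEquiv.apply_symm_apply]
      refine Finset.card_le_card_of_injOn (fun x => Fin.tail (g.symm x)) ?_ ?_
      · intro x hx
        simp only [Finset.coe_filter, Finset.mem_univ, true_and, Set.mem_ofPred_eq] at hx ⊢
        rw [hback x hx.1]
        exact hx.2
      · intro x hx y hy hxy
        simp only [Finset.coe_filter, Finset.mem_univ, true_and, Set.mem_ofPred_eq] at hx hy
        rw [← hback x hx.1, ← hback y hy.1]
        exact congrArg _ hxy
    have hc : Fintype.card (Fin (n + 1) → ZMod 2) = 2 * Fintype.card (Fin n → ZMod 2) := by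
      simp [pow_succ, mul_comm]
    beta_reduce
    rw [hc]
    have := Nat.mul_le_mul_left (25 * 2 ^ d) hle
    rw [show 50 * 2 ^ d = 2 * (25 * 2 ^ d) by ring, mul_assoc]
    omega

theorem rejProb_ge_of_many_close {d : ℕ} {f : V → ZMod 2} (hf : IsFar d f)
    [Nonempty (AffInj (Fin (d + 2) → ZMod 2) V)] (K : Finset (V →ᵃ[ZMod 2] ZMod 2))
    (hK : ∀ ℓ ∈ K, IsCloseOn d f ℓ) (hcard : 72 * 2 ^ d < K.card) :
    (84 / 625 : ℝ) ≤ rejProb (Fin (d + 2) → ZMod 2) (d + 1) f := by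
  obtain ⟨Q, hQ, hclose⟩ := exists_close_of_many_hyperplanes f K hK (by rw [pow_add]; omega)
  refine le_trans ?_ (rejProb_lower (m := d + 2) (by omega) f Q hQ _ rfl)
  have hfar := hf Q hQ
  set B := (Finset.univ.filter fun x => f x ≠ Q x).card
  set N := Fintype.card V with hN
  have hN0 : (0 : ℝ) < N := by exact_mod_cast Fintype.card_pos
  have hD : (0 : ℝ) < 2 ^ d := by positivity
  have hfar' : (N : ℝ) ≤ 25 * 2 ^ d * B := by exact_mod_cast hfar
  have hlow : 4 / 25 ≤ (2 : ℝ) ^ (d + 2) * (B / N) := by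
    rw [pow_add, mul_div_assoc', div_le_div_iff₀ (by norm_num) hN0]
    linarith
  have hcard' : (72 : ℝ) * 2 ^ d ≤ K.card := by exact_mod_cast hcard.le
  have hupp : (2 : ℝ) ^ (d + 2) * (B / N) ≤ 37 / 50 := by
    have h1 : (9 : ℝ) / K.card ≤ 9 / (72 * 2 ^ d) := by gcongr
    calc (2 : ℝ) ^ (d + 2) * (B / N) ≤ 2 ^ (d + 2) * (3 / (50 * 2 ^ d) + 9 / (72 * 2 ^ d)) := by
          gcongr
          exact hclose.trans (by gcongr)
      _ = 37 / 50 := by rw [pow_add]; field_simp; norm_num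
  nlinarith

theorem rejProb_ge_of_isFar {d k n : ℕ} (hk : d + 10 ≤ k) (hn : k ≤ n)
    (f : (Fin n → ZMod 2) → ZMod 2) (hf : IsFar d f) :
    (1 / 16 : ℝ) + 72 * 2 ^ d / 2 ^ n ≤ rejProb (Fin k → ZMod 2) (d + 1) f := by
  have hpow : ∀ m, k ≤ m → (2 : ℝ) ^ d / 2 ^ m ≤ 1 / 1024 := by
    intro m hm
    rw [div_le_div_iff₀ (by positivity) (by norm_num)]
    calc (2 : ℝ) ^ d * 1024 = 2 ^ (d + 10) := by rw [pow_add]; norm_num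
      _ ≤ 2 ^ m := pow_le_pow_right₀ (by norm_num) (by omega)
      _ = 1 * 2 ^ m := (one_mul _).symm
  induction n, hn using Nat.le_induction with
  | base =>
    have hrej : rejProb (Fin k → ZMod 2) (d + 1) f = 1 := by
      obtain ⟨φ₀⟩ := nonempty_affInj (le_refl k)
      have : Nonempty (AffInj (Fin k → ZMod 2) (Fin k → ZMod 2)) := ⟨φ₀⟩
      refine rejProb_eq_one fun φ hdeg => ?_
      obtain ⟨g, hg⟩ := φ.exists_smul_eq ⟨AffineMap.id _ _, Function.injective_id⟩
      have hg' : ∀ x, g (φ.1 x) = x := fun x =>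
        congrArg (fun ψ : AffInj (Fin k → ZMod 2) (Fin k → ZMod 2) => ψ.1 x) hg
      have hφ : ∀ y, φ.1 (g y) = y := fun y => g.injective (hg' (g y))
      have hfd : DegLT (d + 1) f := by
        have := hdeg.comp_affine g.toAffineMap
        simpa [hφ] using this
      have := hf f hfd
      simp at this
    rw [hrej, mul_div_assoc]
    have := hpow k le_rfl
    linarith
  | succ n hn ih =>
    set K : Finset ((Fin (n + 1) → ZMod 2) →ᵃ[ZMod 2] ZMod 2) :=
      Finset.univ.filter fun ℓ => IsCloseOn d f ℓ with hKdef
    set t : ℝ := 2 ^ d / 2 ^ n with ht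
    have ht0 : 0 < t := by positivity
    have ht1 : t ≤ 1 / 1024 := hpow n hn
    have hgoal : (1 / 16 : ℝ) + 72 * 2 ^ d / 2 ^ (n + 1) = 1 / 16 + 36 * t := by
      rw [ht, pow_succ]; field_simp; ring
    rw [hgoal]
    rcases Nat.lt_or_ge (72 * 2 ^ d) K.card with hK | hK
    · obtain ⟨φ⟩ := nonempty_affInj (show k ≤ n + 1 by omega)
      obtain ⟨ψ⟩ := nonempty_affInj (show d + 2 ≤ k by omega)
      have : Nonempty (AffInj (Fin (d + 2) → ZMod 2) (Fin (n + 1) → ZMod 2)) := ⟨φ.comp ψ⟩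
      have h1 := rejProb_ge_of_many_close hf K (fun ℓ hℓ => by simpa [hKdef] using hℓ) hK
      have h2 := rejProb_mono φ ψ (d + 1) f
      linarith
    · set r : ℝ := 1 / 16 + 72 * t with hr
      have hr' : r = 1 / 16 + 72 * 2 ^ d / 2 ^ n := by rw [hr, ht]; ring
      rw [rejProb_eq_expect (consZero n) (nonempty_affInj hn)]
      let F : AffFunctional (Fin (n + 1) → ZMod 2) → ℝ := fun ℓ =>
        r - r * if IsCloseOn d f ℓ.1 then 1 else 0
      have hge : 𝔼 g, F ((firstCoord n).smul g) ≤
          𝔼 g, rejProb (Fin k → ZMod 2) (d + 1) fun w => f (((consZero n).smul g).1 w) := by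
        refine Finset.expect_le_expect fun g _ => ?_
        by_cases hc : IsCloseOn d f ((firstCoord n).smul g).1
        · simp only [F, if_pos hc]
          rw [mul_one, sub_self]
          exact rejProb_nonneg _ _
        · simp only [F, if_neg hc]
          rw [mul_zero, sub_zero, hr']
          exact ih _ (isFar_of_not_isCloseOn g hc)
      refine le_trans ?_ hge
      have : Nonempty (AffFunctional (Fin (n + 1) → ZMod 2)) := ⟨firstCoord n⟩
      rw [AffFunctional.expect_smul, Finset.expect_sub_distrib, Fintype.expect_const,
        ← Finset.mul_expect, card_filter_expect]
      set c := (Finset.univ.filter fun ℓ : AffFunctional (Fin (n + 1) → ZMod 2) =>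
        IsCloseOn d f ℓ.1).card
      set X := Fintype.card (AffFunctional (Fin (n + 1) → ZMod 2))
      have hc : c ≤ K.card := by
        refine Finset.card_le_card_of_injOn Subtype.val ?_ Subtype.val_injective.injOn
        intro ℓ hℓ
        simpa [hKdef] using hℓ
      have hX : 2 * 2 ^ n ≤ X := by
        have h1 := AffFunctional.card_add_two_ge (V := Fin (n + 1) → ZMod 2)
        have h2 : Fintype.card (Fin (n + 1) → ZMod 2) = 2 * 2 ^ n := by simp [pow_succ, mul_comm]
        have h3 := Nat.one_le_two_pow (n := n)
        rw [h2] at h1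
        omega
      have hX' : (2 : ℝ) * 2 ^ n ≤ X := by exact_mod_cast hX
      have hc' : (c : ℝ) ≤ 72 * 2 ^ d := by exact_mod_cast hc.trans hK
      have hratio : (c : ℝ) / X ≤ 36 * t := by
        calc (c : ℝ) / X ≤ 72 * 2 ^ d / (2 * 2 ^ n) := by gcongr
          _ = 36 * t := by rw [ht]; field_simp; norm_num
      have hr1 : r ≤ 1 := by rw [hr]; linarith
      have hcX : 0 ≤ (c : ℝ) / X := by positivity
      have : r * ((c : ℝ) / X) ≤ 36 * t := by nlinarith
      rw [hr] at this ⊢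
      linarith

theorem Rej_eq_rejProb (n d k : ℕ) (f : (Fin n → ZMod 2) → ZMod 2) :
    Rej n d k f = rejProb (Fin k → ZMod 2) (d + 1) f := by
  let e : Matrix (Fin n) (Fin k) (ZMod 2) × (Fin n → ZMod 2) ≃
      ((Fin k → ZMod 2) →ᵃ[ZMod 2] (Fin n → ZMod 2)) :=
    (Equiv.prodComm _ _).trans (((Equiv.refl _).prodCongr Matrix.toLin'.toEquiv).trans
      (AffineMap.toConstProdLinearMap (ZMod 2)).symm.toEquiv)
  have he : ∀ Mb u, e Mb u = Mb.1.mulVec u + Mb.2 := by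
    intro Mb u
    simp [e, AffineMap.toConstProdLinearMap]
  have hinj : ∀ Mb, Function.Injective Mb.1.mulVec ↔ Function.Injective (e Mb) := by
    intro Mb
    have : (e Mb : (Fin k → ZMod 2) → Fin n → ZMod 2) = (fun y => y + Mb.2) ∘ Mb.1.mulVec :=
      funext fun u => he Mb u
    rw [this]
    exact (Function.Injective.of_comp_iff (add_left_injective Mb.2) _).symm
  let e' : {Mb : Matrix (Fin n) (Fin k) (ZMod 2) × (Fin n → ZMod 2) //
      Function.Injective Mb.1.mulVec} ≃ AffInj (Fin k → ZMod 2) (Fin n → ZMod 2) :=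
    e.subtypeEquiv hinj
  have he' : ∀ Mb u, (e' Mb).1 u = Mb.1.1.mulVec u + Mb.1.2 := fun Mb u => he Mb.1 u
  rw [rejProb_eq_sum_div_card e', Fintype.card_subtype, Rej]
  congr 1
  simp_rw [he', ← degLE_iff_degLT]
  rw [← Finset.filter_filter, ← Finset.sum_boole,
    Finset.sum_subtype (p := fun Mb => Function.Injective Mb.1.mulVec) _ (fun x => by simp)]
  refine Finset.sum_congr rfl fun Mb _ => ?_
  rw [ite_not]

theorem isFar_of_deltaD {n d : ℕ} {f : (Fin n → ZMod 2) → ZMod 2}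
    (hf : (1/25 : ℝ) * (2:ℝ) ^ (-(d:ℤ)) ≤ deltaD n d f) : IsFar d f := by
  intro Q hQ
  have h1 : deltaD n d f ≤ hdist n f Q := by
    refine csInf_le ⟨0, ?_⟩ ⟨Q, degLE_of_degLT hQ, rfl⟩
    rintro r ⟨g, -, rfl⟩
    unfold hdist
    positivity
  have h2 := hf.trans h1
  rw [hdist, zpow_neg, zpow_natCast, ← div_eq_mul_inv, div_div,
    div_le_div_iff₀ (by positivity) (by positivity)] at h2
  have h3 : Fintype.card (Fin n → ZMod 2) = 2 ^ n := by simp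
  rw [h3]
  have h4 : (2 : ℝ) ^ n ≤
      25 * 2 ^ d * (Finset.univ.filter fun x => f x ≠ Q x).card := by linarith
  exact_mod_cast h4

end Induction


theorem statement4 (d k n : ℕ) (hk : d + 10 ≤ k) (hn : k ≤ n)
    (f : (Fin n → ZMod 2) → ZMod 2)
    (hf : (1/25 : ℝ) * (2:ℝ) ^ (-(d:ℤ)) ≤ deltaD n d f) :
    (1/16 : ℝ) + 72 * (2:ℝ) ^ d / 2 ^ n ≤ Rej n d k f := by
  rw [Rej_eq_rejProb]
  exact rejProb_ge_of_isFar hk hn f (isFar_of_deltaD hf)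

end
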